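/- Let Q be a finite maximal antichain in the homomorphism order C_Δ, and let D* be the sum of all Δ-trees with at most one edge of each kind. Suppose that every element Q ∈ Q has the property that whenever Y < Q and Y → D*, there exists a Δ-structure X with Y < X < Q and X ↛ D*. Then the antichain Q splits. -/

import Mathlib

/-! Framework: finite relational structures of a fixed type Δ = (δ i : i ∈ I),
homomorphisms, cores, sums, products, exponentials, shadows, trees, forests,
duality pairs, finite dualities, transversals, antichains. -/

namespace ThesisFormal

/-- A finite relational structure of type `Δ = (δ i : i ∈ I)`:
a finite nonempty base set together with a `δ i`-ary relation for each `i ∈ I`. -/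
structure RelStruct (I : Type) (δ : I → ℕ) : Type 1 where
  carrier : Type
  finite : Finite carrier
  nonempty : Nonempty carrier
  rel : ∀ i : I, Set ((Fin (δ i)) → carrier)

namespace RelStruct

variable {I : Type} {δ : I → ℕ}

/-- `f` is a homomorphism from `A` to `B`. -/
def IsHom (A B : RelStruct I δ) (f : A.carrier → B.carrier) : Prop :=
  ∀ i : I, ∀ e ∈ A.rel i, (f ∘ e) ∈ B.rel i

/-- `A → B`: some homomorphism from `A` to `B` exists. -/
def HomTo (A B : RelStruct I δ) : Prop := ∃ f, IsHom A B f

/-- `A ≈ B`: homomorphic equivalence. -/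
def HomEquiv (A B : RelStruct I δ) : Prop := HomTo A B ∧ HomTo B A

/-- `A` and `B` are incomparable: no homomorphism either way. -/
def Incomparable (A B : RelStruct I δ) : Prop := ¬ HomTo A B ∧ ¬ HomTo B A

/-- `A ≅ B`: a bijective homomorphism whose inverse is also a homomorphism. -/
def Isomorphic (A B : RelStruct I δ) : Prop :=
  ∃ f : A.carrier ≃ B.carrier, IsHom A B f ∧ IsHom B A f.symm

/-- A retraction of `A`: an endomorphism fixing its image pointwise. -/
def IsRetraction (A : RelStruct I δ) (f : A.carrier → A.carrier) : Prop :=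
  IsHom A A f ∧ ∀ x ∈ Set.range f, f x = x

/-- A core: a structure with no proper retracts (every retraction is surjective). -/
def IsCore (A : RelStruct I δ) : Prop :=
  ∀ f, IsRetraction A f → Function.Surjective f

/-- The substructure of `A` induced by a nonempty `S ⊆ |A|`. -/
noncomputable def Substruct (A : RelStruct I δ) (S : Set A.carrier) (hS : S.Nonempty) :
    RelStruct I δ where
  carrier := S
  finite := by haveI := A.finite; exact Subtype.finite
  nonempty := hS.to_subtype
  rel i := {e | (fun j => (e j : A.carrier)) ∈ A.rel i}

/-- `C` is a retract of `A`: the substructure induced by the image of a retraction. -/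
def IsRetractOf (C A : RelStruct I δ) : Prop :=
  ∃ f, IsRetraction A f ∧
    C = A.Substruct (Set.range f) ⟨f A.nonempty.some, Set.mem_range_self _⟩

/-- The sum (disjoint union) `A + B`. -/
noncomputable def sum (A B : RelStruct I δ) : RelStruct I δ where
  carrier := A.carrier ⊕ B.carrier
  finite := by haveI := A.finite; haveI := B.finite; infer_instance
  nonempty := ⟨Sum.inl A.nonempty.some⟩
  rel i := {e | (∃ ea ∈ A.rel i, e = Sum.inl ∘ ea) ∨ (∃ eb ∈ B.rel i, e = Sum.inr ∘ eb)}

/-- The product `A × B`. -/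
noncomputable def prod (A B : RelStruct I δ) : RelStruct I δ where
  carrier := A.carrier × B.carrier
  finite := by haveI := A.finite; haveI := B.finite; infer_instance
  nonempty := ⟨(A.nonempty.some, B.nonempty.some)⟩
  rel i := {e | (fun j => (e j).1) ∈ A.rel i ∧ (fun j => (e j).2) ∈ B.rel i}

/-- The exponential structure `C ^ B`. -/
noncomputable def exp (C B : RelStruct I δ) : RelStruct I δ where
  carrier := B.carrier → C.carrier
  finite := by haveI := B.finite; haveI := C.finite; infer_instance
  nonempty := ⟨fun _ => C.nonempty.some⟩
  rel i := {f | ∀ e ∈ B.rel i, (fun j => f j (e j)) ∈ C.rel i}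

/-- The sum of a finite nonempty family of structures. -/
noncomputable def sigmaSum {J : Type} (hJfin : Finite J) (hJne : Nonempty J)
    (A : J → RelStruct I δ) : RelStruct I δ where
  carrier := Σ j, (A j).carrier
  finite := by
    haveI := hJfin
    haveI : ∀ j, Finite ((A j).carrier) := fun j => (A j).finite
    infer_instance
  nonempty := ⟨⟨hJne.some, (A hJne.some).nonempty.some⟩⟩
  rel i := {e | ∃ j, ∃ ea ∈ (A j).rel i, e = fun k => ⟨j, ea k⟩}

/-- The product of a finite family of structures. -/
noncomputable def piProd {J : Type} (hJfin : Finite J)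
    (A : J → RelStruct I δ) : RelStruct I δ where
  carrier := ∀ j, (A j).carrier
  finite := by
    haveI := hJfin
    haveI : ∀ j, Finite ((A j).carrier) := fun j => (A j).finite
    infer_instance
  nonempty := ⟨fun j => (A j).nonempty.some⟩
  rel i := {e | ∀ j, (fun k => e k j) ∈ (A j).rel i}

/-- An edge of the shadow multigraph `Sh(A)`: one edge joining `e j` and `e (j+1)`
for each edge `e ∈ R i (A)` and each `j` with `j + 1 < δ i`. -/
structure ShadowEdge (A : RelStruct I δ) : Type where
  i : I
  e : Fin (δ i) → A.carrier
  mem : e ∈ A.rel i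
  j : ℕ
  hj : j + 1 < δ i

/-- First endpoint of a shadow edge. -/
def ShadowEdge.src {A : RelStruct I δ} (s : ShadowEdge A) : A.carrier :=
  s.e ⟨s.j, Nat.lt_of_succ_lt s.hj⟩

/-- Second endpoint of a shadow edge. -/
def ShadowEdge.tgt {A : RelStruct I δ} (s : ShadowEdge A) : A.carrier :=
  s.e ⟨s.j + 1, s.hj⟩

/-- The adjacency relation of the shadow `Sh(A)`. -/
def shadowAdj (A : RelStruct I δ) (a b : A.carrier) : Prop :=
  ∃ s : ShadowEdge A, (s.src = a ∧ s.tgt = b) ∨ (s.src = b ∧ s.tgt = a)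

/-- The shadow of `A` is connected. -/
def ShadowConnected (A : RelStruct I δ) : Prop :=
  ∀ a b : A.carrier, Relation.ReflTransGen (shadowAdj A) a b

/-- `A` is a Δ-tree: its shadow multigraph is a tree, i.e. it is connected and
the number of edge occurrences is one less than the number of vertices
(this rules out cycles, loops and parallel edges). -/
def IsTreeStruct (A : RelStruct I δ) : Prop :=
  ShadowConnected A ∧ Nat.card (ShadowEdge A) + 1 = Nat.card A.carrier

/-- The number of connected components of the shadow of `A`. -/
noncomputable def numComponents (A : RelStruct I δ) : ℕ :=
  Nat.card (Quot (shadowAdj A))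

/-- `A` is a Δ-forest: every component of its shadow multigraph is a tree. -/
def IsForestStruct (A : RelStruct I δ) : Prop :=
  Nat.card (ShadowEdge A) + numComponents A = Nat.card A.carrier

/-- The component of `A` containing the vertex `a`. -/
noncomputable def componentOf (A : RelStruct I δ) (a : A.carrier) : RelStruct I δ :=
  A.Substruct {b | Relation.ReflTransGen (shadowAdj A) a b}
    ⟨a, Relation.ReflTransGen.refl⟩

/-- `(F, D)` is a duality pair: for every `A`, `F → A` iff `A ↛ D`. -/
def DualityPair (F D : RelStruct I δ) : Prop :=
  ∀ A : RelStruct I δ, HomTo F A ↔ ¬ HomTo A D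

/-- `(F, D)` is a finite homomorphism duality: `F` and `D` are finite sets of
pairwise incomparable cores and for every `X`, some member of `F` maps to `X`
iff `X` maps to no member of `D`. -/
def FiniteDuality (F D : Set (RelStruct I δ)) : Prop :=
  F.Finite ∧ D.Finite ∧
  (∀ A ∈ F, IsCore A) ∧ (∀ A ∈ D, IsCore A) ∧
  F.Pairwise Incomparable ∧ D.Pairwise Incomparable ∧
  ∀ X : RelStruct I δ, (∃ A ∈ F, HomTo A X) ↔ (∀ B ∈ D, ¬ HomTo X B)

/-- The set of connected components of `A`. -/
def componentsSet (A : RelStruct I δ) : Set (RelStruct I δ) :=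
  {C | ∃ a : A.carrier, C = componentOf A a}

/-- The set `ℱ_c` of connected components of the members of `F`. -/
def componentsOfFamily (F : Set (RelStruct I δ)) : Set (RelStruct I δ) :=
  ⋃ A ∈ F, componentsSet A

/-- A quasitransversal over `F`: a set of pairwise incomparable components of
members of `F` supporting `F`. -/
def Quasitransversal (F M : Set (RelStruct I δ)) : Prop :=
  M ⊆ componentsOfFamily F ∧ M.Pairwise Incomparable ∧
  ∀ A ∈ F, ∃ C ∈ M, HomTo C A

/-- The order on quasitransversals: `M ⪯ M'` iff every member of `M'` admits a
homomorphism from some member of `M`. -/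
def QTle (M M' : Set (RelStruct I δ)) : Prop :=
  ∀ C' ∈ M', ∃ C ∈ M, HomTo C C'

/-- A transversal: a `⪯`-maximal quasitransversal. -/
def IsTransversal (F M : Set (RelStruct I δ)) : Prop :=
  Quasitransversal F M ∧ ∀ M', Quasitransversal F M' → QTle M M' → M' = M

/-- The product of a family of structures indexed by `Fin n`. -/
noncomputable def finProd (n : ℕ) (A : Fin n → RelStruct I δ) : RelStruct I δ :=
  piProd (inferInstance : Finite (Fin n)) A

/-- `D` is (isomorphic to) `D(M)`, the core of the product of the duals `D(C)`
of the members `C` of the finite set `M`. -/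
def IsSetDual (M : Set (RelStruct I δ)) (D : RelStruct I δ) : Prop :=
  IsCore D ∧ ∃ (n : ℕ) (C DC : Fin n → RelStruct I δ),
    Function.Injective C ∧ Set.range C = M ∧
    (∀ k, IsCore (DC k) ∧ DualityPair (C k) (DC k)) ∧
    HomEquiv D (finProd n DC)

/-- `D` is the result (up to isomorphism) of the transversal construction on `F`:
its members are exactly the duals of the transversals over `F`, one for each
transversal. -/
def TransversalDualSet (F D : Set (RelStruct I δ)) : Prop :=
  (∀ d ∈ D, ∃ M, IsTransversal F M ∧ IsSetDual M d) ∧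
  (∀ M, IsTransversal F M → ∃ d ∈ D, IsSetDual M d) ∧
  (∀ d ∈ D, ∀ d' ∈ D, ∀ M : Set (RelStruct I δ),
    IsSetDual M d → IsSetDual M d' → d = d')

/-- `Q` is a maximal antichain in the homomorphism order: a set of pairwise
incomparable cores such that every structure is comparable with some member. -/
def IsMaxAntichain (Q : Set (RelStruct I δ)) : Prop :=
  (∀ A ∈ Q, IsCore A) ∧ Q.Pairwise Incomparable ∧
  ∀ X : RelStruct I δ, ∃ A ∈ Q, HomTo X A ∨ HomTo A X

/-- The maximal antichain `Q` splits. -/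
def Splits (Q : Set (RelStruct I δ)) : Prop :=
  ∃ Q₁ Q₂ : Set (RelStruct I δ), Q₁ ∪ Q₂ = Q ∧ Disjoint Q₁ Q₂ ∧
    ∀ X : RelStruct I δ, (∃ A ∈ Q₁, HomTo A X) ∨ (∃ B ∈ Q₂, HomTo X B)

/-- `A < B` in the homomorphism order. -/
def StrictHom (A B : RelStruct I δ) : Prop := HomTo A B ∧ ¬ HomTo B A

/-- (The homomorphic-equivalence class of) `Y` is a cutting point in the
homomorphism order. -/
def CuttingPoint (Y : RelStruct I δ) : Prop :=
  ∃ X Z : RelStruct I δ, StrictHom X Y ∧ StrictHom Y Z ∧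
    ∀ W : RelStruct I δ, HomTo X W → HomTo W Z → (HomTo W Y ∨ HomTo Y W)

/-- `A` has at most one edge of each kind. -/
def AtMostOneEdgePerKind (A : RelStruct I δ) : Prop :=
  ∀ i : I, ∀ e ∈ A.rel i, ∀ e' ∈ A.rel i, e = e'

end RelStruct

end ThesisFormal

namespace ThesisFormal

open Filter in
/-- A finitely coloured sequence has a limit along an ultrafilter. -/
theorem exists_eventually_eq_of_finite {α C : Type*} [Finite C] (U : Ultrafilter α) (h : α → C) :
    ∃ c, ∀ᶠ n in (U : Filter α), h n = c :=
  Ultrafilter.eventually_exists_iff.mp (Eventually.of_forall fun n => ⟨h n, rfl⟩)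

open Filter in
/-- Finite Ramsey theorem: a finite colouring of the `k`-subsets of `ℕ` has monochromatic sets of
every finite size. -/
theorem exists_monochromatic_finset {C : Type*} [Finite C] (k n : ℕ) (f : Finset ℕ → C) :
    ∃ c, ∃ M : Finset ℕ, M.card = n ∧ ∀ s ⊆ M, s.card = k → f s = c := by
  classical
  let U : Ultrafilter ℕ := hyperfilter ℕ
  have hU : ∀ m : ℕ, ∀ᶠ b in (U : Filter ℕ), m < b := fun m =>
    (Nat.hyperfilter_le_atTop : (U : Filter ℕ) ≤ atTop) (eventually_gt_atTop m)
  choose lim hlim using fun h : ℕ → C => exists_eventually_eq_of_finite U h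
  let F : ℕ → Finset ℕ → C := fun j =>
    Nat.rec f (fun _ G s => lim fun b => G (insert b s)) j
  have hF : ∀ j s, ∀ᶠ b in (U : Filter ℕ), F j (insert b s) = F (j + 1) s :=
    fun j s => hlim fun b => F j (insert b s)
  suffices H : ∀ n, ∃ M : Finset ℕ, M.card = n ∧
      ∀ s ⊆ M, s.card ≤ k → F (k - s.card) s = F k ∅ by
    obtain ⟨M, hM, h⟩ := H n
    refine ⟨F k ∅, M, hM, fun s hs hk => ?_⟩
    have := h s hs hk.le
    rwa [hk, Nat.sub_self] at this
  intro n
  induction n with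
  | zero => exact ⟨∅, rfl, fun s hs _ => by rw [Finset.subset_empty.mp hs]; simp⟩
  | succ n ih =>
    obtain ⟨M, hM, h⟩ := ih
    have h1 : ∀ᶠ b in (U : Filter ℕ), ∀ s ∈ M.powerset,
        F (k - s.card - 1) (insert b s) = F (k - s.card - 1 + 1) s :=
      (Finset.eventually_all _).mpr fun s _ => hF _ s
    obtain ⟨b, hb, hbM⟩ := (h1.and (hU (M.sup id))).exists
    have hbn : b ∉ M := fun hm => absurd (Finset.le_sup (f := id) hm) (not_le.mpr hbM)
    refine ⟨insert b M, by rw [Finset.card_insert_of_notMem hbn, hM], fun s hs hk => ?_⟩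
    by_cases hbs : b ∈ s
    · have hsM : s.erase b ⊆ M := Finset.subset_insert_iff.mp hs
      have hc := Finset.card_erase_add_one hbs
      have h2 := hb _ (Finset.mem_powerset.mpr hsM)
      have h3 := h _ hsM (by omega)
      rw [Finset.insert_erase hbs] at h2
      rw [show k - s.card = k - (s.erase b).card - 1 by omega, h2,
        show k - (s.erase b).card - 1 + 1 = k - (s.erase b).card by omega, h3]
    · exact h s ((Finset.subset_insert_iff_of_notMem hbs).mp hs) hk

open Filter in
/-- Finite Ramsey theorem: the monochromatic set can be found below a uniform bound. -/
theorem exists_monochromatic_finset_range (C : Type*) [Finite C] (k n : ℕ) :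
    ∃ N, ∀ f : Finset ℕ → C,
      ∃ c, ∃ M ⊆ Finset.range N, M.card = n ∧ ∀ s ⊆ M, s.card = k → f s = c := by
  by_contra! H
  choose f hf using H
  let U : Ultrafilter ℕ := hyperfilter ℕ
  choose g hg using fun s => exists_eventually_eq_of_finite U fun N => f N s
  obtain ⟨c, M, hM, h⟩ := exists_monochromatic_finset k n g
  have h1 : ∀ᶠ N in (U : Filter ℕ), ∀ s ∈ M.powerset, f N s = g s :=
    (Finset.eventually_all _).mpr fun s _ => hg s
  have h2 : ∀ᶠ N in (U : Filter ℕ), M.sup id < N :=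
    (Nat.hyperfilter_le_atTop : (U : Filter ℕ) ≤ atTop) (eventually_gt_atTop _)
  obtain ⟨N, hN, hMN⟩ := (h1.and h2).exists
  obtain ⟨s, hs, hk, hne⟩ := hf N c M
    (fun x hx => Finset.mem_range.mpr ((Finset.le_sup (f := id) hx).trans_lt hMN)) hM
  exact hne ((hN s (Finset.mem_powerset.mpr hs)).trans (h s hs hk))

/-- Ramsey theorem for colourings of functions on a finite set `B` of reals: for some increasing
`τ` on a finite set `E`, all increasing functions on `B` with values in `τ '' E` get the same
colour. -/
theorem exists_monochromatic_strictMonoOn (C : Type*) [Finite C] (B E : Finset ℝ) :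
    ∃ N, ∀ f : (B → ℕ) → C, ∃ c, ∃ τ : ℝ → ℕ, StrictMonoOn τ E ∧ (∀ r, τ r ≤ N) ∧
      ∀ σ : B → ℕ, StrictMono σ → (∀ b, σ b ∈ τ '' E) → f σ = c := by
  classical
  obtain ⟨N, hN⟩ := exists_monochromatic_finset_range C B.card E.card
  refine ⟨N, fun f => ?_⟩
  obtain ⟨c, M, hMN, hM, h⟩ := hN fun s =>
    f fun b => if hs : s.card = B.card then
      s.orderEmbOfFin hs ((B.orderIsoOfFin rfl).symm b) else 0
  refine ⟨c, fun r => if hr : r ∈ E then M.orderEmbOfFin hM ((E.orderIsoOfFin rfl).symm ⟨r, hr⟩)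
    else 0, ?_, ?_, ?_⟩
  · intro a ha b hb hab
    have ha' : a ∈ E := ha
    have hb' : b ∈ E := hb
    simp only [ha', hb', dif_pos]
    simpa using hab
  · intro r
    dsimp only
    split_ifs with hr
    · exact (Finset.mem_range.mp (hMN (M.orderEmbOfFin_mem hM _))).le
    · exact Nat.zero_le _
  · intro σ hσ hσE
    have hcard : (Finset.univ.image σ).card = B.card := by
      rw [Finset.card_image_of_injective _ hσ.injective]; simp
    have hsub : Finset.univ.image σ ⊆ M := by
      intro x hx
      obtain ⟨b, -, rfl⟩ := Finset.mem_image.mp hx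
      obtain ⟨r, hr, hrb⟩ := hσE b
      have hr' : r ∈ E := hr
      simp only [hr', dif_pos] at hrb
      rw [← hrb]
      exact M.orderEmbOfFin_mem hM _
    have huniq := Finset.orderEmbOfFin_unique hcard
      (f := fun j => σ (B.orderIsoOfFin rfl j)) (fun j => by simp)
      (hσ.comp (B.orderIsoOfFin rfl).strictMono)
    rw [← h _ hsub hcard]
    congr 1
    funext b
    rw [dif_pos hcard, ← congrFun huniq]
    simp

/-- There are infinitely many rationally independent reals, indexed by any countable type. -/
theorem exists_linearIndependent_real (α : Type) [Countable α] :
    ∃ g : α → ℝ, LinearIndependent ℚ g := by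
  let b := Module.Basis.ofVectorSpace ℚ ℝ
  have hinf : Infinite (Module.Basis.ofVectorSpaceIndex ℚ ℝ) := by
    rw [Cardinal.infinite_iff, b.mk_eq_rank'', Real.rank_rat_real]
    exact Cardinal.aleph0_le_continuum
  obtain ⟨f, hf⟩ := Countable.exists_injective_nat α
  let f' := Infinite.natEmbedding (Module.Basis.ofVectorSpaceIndex ℚ ℝ)
  exact ⟨_, b.linearIndependent.comp (f' ∘ f) (f'.injective.comp hf)⟩

namespace RelStruct

variable {I : Type} {δ : I → ℕ}

theorem IsHom.comp {A B C : RelStruct I δ} {g : B.carrier → C.carrier} {f : A.carrier → B.carrier}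
    (hg : IsHom B C g) (hf : IsHom A B f) : IsHom A C (g ∘ f) :=
  fun i e he => hg i _ (hf i e he)

theorem HomTo.trans {A B C : RelStruct I δ} (h₁ : HomTo A B) (h₂ : HomTo B C) : HomTo A C :=
  let ⟨f, hf⟩ := h₁
  let ⟨g, hg⟩ := h₂
  ⟨g ∘ f, hg.comp hf⟩

theorem homTo_sum_left (A B : RelStruct I δ) : HomTo A (A.sum B) :=
  ⟨Sum.inl, fun _ e he => Or.inl ⟨e, he, rfl⟩⟩

theorem homTo_sum_right (A B : RelStruct I δ) : HomTo B (A.sum B) :=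
  ⟨Sum.inr, fun _ e he => Or.inr ⟨e, he, rfl⟩⟩

/-- `A` is balanced with respect to the weights `w` if it carries a real potential whose
differences along each edge of kind `i` are the differences of the weights `w i`. -/
def Balanced (w : I → ℕ → ℝ) (A : RelStruct I δ) : Prop :=
  ∃ φ : A.carrier → ℝ, ∀ i, ∀ e ∈ A.rel i, ∀ j k : Fin (δ i), φ (e j) + w i k = φ (e k) + w i j

theorem Balanced.of_homTo {w : I → ℕ → ℝ} {A B : RelStruct I δ} (h : HomTo A B)
    (hB : B.Balanced w) : A.Balanced w :=
  let ⟨f, hf⟩ := h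
  let ⟨φ, hφ⟩ := hB
  ⟨φ ∘ f, fun i e he => hφ i _ (hf i e he)⟩

/-- The simple graph joining distinct vertices lying on a common edge of `A`. -/
def gaifman (A : RelStruct I δ) : SimpleGraph A.carrier where
  Adj a b := a ≠ b ∧ ∃ i, ∃ e ∈ A.rel i, a ∈ Set.range e ∧ b ∈ Set.range e
  symm.symm := fun _ _ ⟨hne, i, e, he, ha, hb⟩ => ⟨hne.symm, i, e, he, hb, ha⟩
  loopless.irrefl := fun _ h => h.1 rfl

theorem gaifman_reachable (A : RelStruct I δ) {i : I} {e : Fin (δ i) → A.carrier}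
    (he : e ∈ A.rel i) (j k : Fin (δ i)) : A.gaifman.Reachable (e j) (e k) := by
  by_cases h : e j = e k
  · rw [h]
  · exact SimpleGraph.Adj.reachable ⟨h, i, e, he, ⟨j, rfl⟩, ⟨k, rfl⟩⟩

/-- The reals that are sums of at most `m` differences of weights. -/
def weightSums (δ : I → ℕ) (w : I → ℕ → ℝ) : ℕ → Set ℝ
  | 0 => {0}
  | m + 1 => weightSums δ w m ∪
      Set.range fun p : weightSums δ w m × (Σ i, Fin (δ i) × Fin (δ i)) =>
        (p.1 : ℝ) + (w p.2.1 p.2.2.1 - w p.2.1 p.2.2.2)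

theorem finite_weightSums [Finite I] (w : I → ℕ → ℝ) (m : ℕ) : (weightSums δ w m).Finite := by
  induction m with
  | zero => exact Set.finite_singleton _
  | succ m ih =>
    have := ih.to_subtype
    exact ih.union (Set.finite_range _)

theorem weightSums_mono (w : I → ℕ → ℝ) : Monotone (weightSums δ w) :=
  monotone_nat_of_le_succ fun _ => Set.subset_union_left

/-- The structure of functions `B → {0, …, N}` over the vertices of `X`, an edge of `X` being
lifted to the restrictions of a function `ℝ → {0, …, N}`, injective on `E`, to the translates of `B`
by the weights. -/
noncomputable def shiftStruct (w : I → ℕ → ℝ) (X : RelStruct I δ) (B E : Finset ℝ) (N : ℕ) :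
    RelStruct I δ where
  carrier := X.carrier × (B → Fin (N + 1))
  finite := by have := X.finite; infer_instance
  nonempty := ⟨(X.nonempty.some, fun _ => 0)⟩
  rel i := {t | ∃ e ∈ X.rel i, ∃ T : ℝ → Fin (N + 1), Set.InjOn T E ∧
    ∀ k, t k = (e k, fun b : B => T (b + w i k))}

theorem shiftStruct_homTo (w : I → ℕ → ℝ) (X : RelStruct I δ) (B E : Finset ℝ) (N : ℕ) :
    HomTo (shiftStruct w X B E N) X := by
  refine ⟨Prod.fst, ?_⟩
  rintro i t ⟨e, he, T, -, ht⟩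
  rw [show e = fun k => (t k).1 from funext fun k => (congrArg Prod.fst (ht k)).symm] at he
  exact he

theorem exists_shiftStruct_not_homTo (w : I → ℕ → ℝ) (X : RelStruct I δ) (B E : Finset ℝ)
    (hE : ∀ i, ∀ k : Fin (δ i), ∀ b ∈ B, b + w i k ∈ E) (A : RelStruct I δ) (hA : ¬ HomTo X A) :
    ∃ N₀, ∀ N ≥ N₀, ¬ HomTo (shiftStruct w X B E N) A := by
  have := X.finite
  have := A.finite
  obtain ⟨N₀, hN₀⟩ := exists_monochromatic_strictMonoOn (X.carrier → A.carrier) B E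
  refine ⟨N₀, fun N hN ⟨h, hh⟩ => hA ?_⟩
  obtain ⟨c, τ, hτ, hτN, hc⟩ := hN₀ fun σ x => h (x, fun b => Fin.ofNat (N + 1) (σ b))
  refine ⟨c, fun i e he => ?_⟩
  have hmem := hh i (fun k => (e k, fun b : B => Fin.ofNat (N + 1) (τ (b + w i k))))
    ⟨e, he, fun r => Fin.ofNat (N + 1) (τ r), fun r hr s hs hrs => hτ.injOn hr hs ?_, fun k => rfl⟩
  · convert hmem using 1
    funext k
    have := congrFun (hc (fun b => τ (b + w i k))
      (fun b b' hbb => hτ (hE i k b b.2) (hE i k b' b'.2) (by simpa using hbb))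
      fun b => ⟨_, hE i k b b.2, rfl⟩) (e k)
    exact this.symm
  · have := congrArg Fin.val hrs
    simp only [Fin.val_ofNat] at this
    rwa [Nat.mod_eq_of_lt (by have := hτN r; omega),
      Nat.mod_eq_of_lt (by have := hτN s; omega)] at this

theorem balanced_of_homTo_shiftStruct (w : I → ℕ → ℝ) (X : RelStruct I δ) (B E : Finset ℝ)
    (N m : ℕ) (hB : weightSums δ w m ⊆ B)
    (hE : ∀ i, ∀ k : Fin (δ i), ∀ b ∈ B, b + w i k ∈ E) (F : RelStruct I δ)
    (hFm : Nat.card F.carrier ≤ m) (hF : HomTo F (shiftStruct w X B E N)) : F.Balanced w := by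
  classical
  have := F.finite
  have := Fintype.ofFinite F.carrier
  obtain ⟨h, hh⟩ := hF
  have h0 : (0 : ℝ) ∈ B := hB (weightSums_mono w (Nat.zero_le m) rfl)
  let marker : F.gaifman.ConnectedComponent → Fin (N + 1) := fun C => (h C.out).2 ⟨0, h0⟩
  have hwalk : ∀ (l : ℕ), l ≤ m → ∀ (u v : F.carrier) (p : F.gaifman.Walk u v), p.length = l →
      ∃ b : B, (b : ℝ) ∈ weightSums δ w l ∧ (h v).2 b = (h u).2 ⟨0, h0⟩ := by
    intro l
    induction l with
    | zero =>
      intro _ u v p hp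
      rw [SimpleGraph.Walk.eq_of_length_eq_zero hp]
      exact ⟨⟨0, h0⟩, rfl, rfl⟩
    | succ l ih =>
      intro hl u v p hp
      obtain ⟨v', p', hvv', hp'⟩ : ∃ v', ∃ p' : F.gaifman.Walk u v', F.gaifman.Adj v' v ∧
          p'.length = l := by
        refine ⟨p.penultimate, p.dropLast, p.adj_penultimate ?_, ?_⟩
        · rw [SimpleGraph.Walk.not_nil_iff_lt_length]; omega
        · simp [hp]
      obtain ⟨b, hbl, hb⟩ := ih (by omega) u v' p' hp'
      obtain ⟨-, i, e, he, ⟨k', rfl⟩, ⟨k, rfl⟩⟩ := hvv'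
      obtain ⟨x, -, T, -, ht⟩ := hh i e he
      have hmem : (b : ℝ) + (w i k' - w i k) ∈ weightSums δ w (l + 1) :=
        Or.inr ⟨(⟨b, hbl⟩, ⟨i, k', k⟩), rfl⟩
      refine ⟨⟨_, hB (weightSums_mono w hl hmem)⟩, hmem, ?_⟩
      rw [← hb, show h (e k) = _ from ht k, show h (e k') = _ from ht k']
      dsimp only
      congr 1
      ring
  have hmark : ∀ v, ∃ b : B, (h v).2 b = marker (F.gaifman.connectedComponentMk v) := by
    intro v
    have hr : F.gaifman.Reachable (F.gaifman.connectedComponentMk v).out v :=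
      SimpleGraph.ConnectedComponent.exact (Quot.out_eq _)
    obtain ⟨p, hp⟩ := hr.exists_isPath
    have hlt := hp.length_lt
    rw [← Nat.card_eq_fintype_card] at hlt
    obtain ⟨b, -, hb⟩ := hwalk _ (by omega) _ _ p rfl
    exact ⟨b, hb⟩
  choose β hβ using hmark
  refine ⟨fun v => - (β v : ℝ), fun i e he j k => ?_⟩
  obtain ⟨x, -, T, hT, ht⟩ := hh i e he
  have key : ∀ k, T (β (e k) + w i k) = marker (F.gaifman.connectedComponentMk (e k)) := by
    intro k
    rw [← hβ, show h (e k) = _ from ht k]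
  have hjk := key j
  rw [SimpleGraph.ConnectedComponent.sound (F.gaifman_reachable he j k), ← key k] at hjk
  have := hT (hE i j _ (β (e j)).2) (hE i k _ (β (e k)).2) hjk
  linarith

/-- Sparse incomparability: below `X` there is a structure that maps to no member of the finite
set `Q` to which `X` does not map, and whose small substructures are all balanced. -/
theorem exists_locally_balanced [Finite I] (w : I → ℕ → ℝ) (X : RelStruct I δ)
    (Q : Set (RelStruct I δ)) (hQ : Q.Finite) (hX : ∀ A ∈ Q, ¬ HomTo X A) (m : ℕ) :
    ∃ Z : RelStruct I δ, HomTo Z X ∧ (∀ A ∈ Q, ¬ HomTo Z A) ∧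
      ∀ F : RelStruct I δ, Nat.card F.carrier ≤ m → HomTo F Z → F.Balanced w := by
  classical
  let B : Finset ℝ := (finite_weightSums (δ := δ) w m).toFinset
  have hfin : (Set.range fun p : B × (Σ i, Fin (δ i)) => (p.1 : ℝ) + w p.2.1 p.2.2).Finite :=
    Set.finite_range _
  have hE : ∀ i, ∀ k : Fin (δ i), ∀ b ∈ B, b + w i k ∈ hfin.toFinset := fun i k b hb => by
    rw [Set.Finite.mem_toFinset]
    exact ⟨(⟨b, hb⟩, ⟨i, k⟩), rfl⟩
  choose! N₀ hN₀ using fun A hA =>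
    exists_shiftStruct_not_homTo w X B hfin.toFinset hE A (hX A hA)
  refine ⟨shiftStruct w X B hfin.toFinset (hQ.toFinset.sup N₀), shiftStruct_homTo .., ?_, ?_⟩
  · exact fun A hA => hN₀ A hA _ (Finset.le_sup (hQ.mem_toFinset.mpr hA))
  · exact fun F hF hFZ => balanced_of_homTo_shiftStruct w X B _ _ m
      (by simp [B]) hE F hF hFZ

/-- The vertices of `linkStruct Y N`: those of `Y`, a copy of every position of every edge of `Y`
in each of the layers `1, …, N`, and one hub tuple for each kind and each component of `Y`. -/
abbrev LinkVertex (Y : RelStruct I δ) (N : ℕ) : Type :=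
  Y.carrier ⊕ ((Σ i, Y.rel i × Fin (δ i)) × Fin N) ⊕
    ((Σ i, Fin (δ i)) × Y.gaifman.ConnectedComponent)

/-- The vertex in layer `t` lying over the position `k` of the edge `e`. -/
def linkVertex (Y : RelStruct I δ) (N : ℕ) {i : I} (e : Y.rel i) (k : Fin (δ i)) :
    ℕ → LinkVertex Y N
  | 0 => Sum.inl (e.1 k)
  | t + 1 => if h : t < N then Sum.inr (Sum.inl (⟨i, e, k⟩, ⟨t, h⟩))
      else Sum.inr (Sum.inr (⟨i, k⟩, Y.gaifman.connectedComponentMk (e.1 k)))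

/-- The structure obtained from `Y` by linking all edges of the same kind in the same component
by long thick paths. -/
noncomputable def linkStruct [Finite I] (Y : RelStruct I δ) (N : ℕ) : RelStruct I δ where
  carrier := LinkVertex Y N
  finite := by
    have := Y.finite
    have : ∀ i, Finite (Y.rel i) := fun i => Subtype.finite
    have : Finite Y.gaifman.ConnectedComponent := Quot.finite _
    infer_instance
  nonempty := ⟨Sum.inl Y.nonempty.some⟩
  rel i := {t | ∃ e : Y.rel i, ∃ s : ℕ, ∃ l : Fin (δ i) → ℕ, (∀ k, l k = s ∨ l k = s + 1) ∧
    ∀ k, t k = linkVertex Y N e k (l k)}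

/-- The layer of a vertex, with the hub tuples in layer `N + 1`. -/
def layer {Y : RelStruct I δ} {N : ℕ} : LinkVertex Y N → ℕ
  | Sum.inl _ => 0
  | Sum.inr (Sum.inl (_, t)) => t + 1
  | Sum.inr (Sum.inr _) => N + 1

theorem layer_linkVertex (Y : RelStruct I δ) (N : ℕ) {i : I} (e : Y.rel i) (k : Fin (δ i)) (t : ℕ) :
    layer (linkVertex Y N e k t) = min t (N + 1) := by
  cases t with
  | zero => simp [linkVertex, layer]
  | succ t =>
    simp only [linkVertex]
    split_ifs with h
    · simp only [layer]; omega
    · simp only [layer]; omega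

/-- A structure that maps to `Y + linkStruct Y N` and has fewer than `N` vertices maps to `Y`. -/
theorem homTo_of_homTo_sum_linkStruct [Finite I] (hδ : ∀ i, 2 ≤ δ i) (Y F : RelStruct I δ) (N : ℕ)
    (hN : Nat.card F.carrier < N) (hF : HomTo F (Y.sum (linkStruct Y N))) : HomTo F Y := by
  classical
  have := F.finite
  have := Fintype.ofFinite F.carrier
  obtain ⟨h, hh⟩ := hF
  let lay : (Y.sum (linkStruct Y N)).carrier → ℕ := Sum.elim (fun _ => 0) layer
  obtain ⟨t₀, ht₀, hmiss⟩ : ∃ t₀ ∈ Finset.Icc 1 N, t₀ ∉ Finset.univ.image (lay ∘ h) := by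
    by_contra! H
    have h1 := Finset.card_le_card H
    have h2 := Finset.card_image_le (s := (Finset.univ : Finset F.carrier)) (f := lay ∘ h)
    rw [Finset.card_univ, ← Nat.card_eq_fintype_card] at h2
    rw [Nat.card_Icc] at h1
    omega
  rw [Finset.mem_Icc] at ht₀
  have hmiss' : ∀ v, lay (h v) ≠ t₀ := fun v hv =>
    hmiss (Finset.mem_image.mpr ⟨v, Finset.mem_univ _, hv⟩)
  let base : ∀ i : I, Y.gaifman.ConnectedComponent → Fin (δ i) → Y.carrier := fun i C =>
    if H : ∃ e ∈ Y.rel i, ∀ k, Y.gaifman.connectedComponentMk (e k) = C then H.choose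
    else fun _ => Y.nonempty.some
  have hbase : ∀ (i : I) (e : Y.rel i) (k : Fin (δ i)),
      base i (Y.gaifman.connectedComponentMk (e.1 k)) ∈ Y.rel i := by
    intro i e k
    have H : ∃ e' ∈ Y.rel i, ∀ j, Y.gaifman.connectedComponentMk (e' j) =
        Y.gaifman.connectedComponentMk (e.1 k) :=
      ⟨e.1, e.2, fun j => SimpleGraph.ConnectedComponent.sound (Y.gaifman_reachable e.2 j k)⟩
    simp only [base, dif_pos H]
    exact H.choose_spec.1
  let ρ : LinkVertex Y N → Y.carrier
    | Sum.inl y => y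
    | Sum.inr (Sum.inl (⟨i, e, k⟩, t)) => if (t : ℕ) + 1 < t₀ then e.1 k
        else base i (Y.gaifman.connectedComponentMk (e.1 k)) k
    | Sum.inr (Sum.inr (⟨i, k⟩, C)) => base i C k
  have hρ : ∀ (i : I) (e : Y.rel i) (k : Fin (δ i)) (t : ℕ), ρ (linkVertex Y N e k t) =
      if t < t₀ then e.1 k else base i (Y.gaifman.connectedComponentMk (e.1 k)) k := by
    intro i e k t
    cases t with
    | zero => rw [if_pos (by omega)]; rfl
    | succ t =>
      simp only [linkVertex]
      by_cases h : t < N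
      · rw [dif_pos h]
      · rw [dif_neg h, if_neg (by omega)]
  let r : (Y.sum (linkStruct Y N)).carrier → Y.carrier := Sum.elim id ρ
  refine ⟨r ∘ h, fun i e he => ?_⟩
  rcases hh i e he with ⟨ea, hea, heq⟩ | ⟨eb, ⟨e', s, l, hl, heb⟩, heq⟩
  · have : (r ∘ h) ∘ e = ea :=
      funext fun k => congrArg r (congrFun heq k)
    rw [this]
    exact hea
  · have hcomp : ∀ k, ((r ∘ h) ∘ e) k = ρ (linkVertex Y N e' k (l k)) := by
      intro k
      rw [← heb]
      exact congrArg r (congrFun heq k)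
    have hlk : ∀ k, l k ≠ t₀ := by
      intro k hk
      have h1 : h (e k) = Sum.inr (linkVertex Y N e' k (l k)) := by
        rw [← heb]; exact congrFun heq k
      refine hmiss' (e k) ?_
      rw [h1]
      refine (layer_linkVertex Y N e' k (l k)).trans ?_
      omega
    have k₀ : Fin (δ i) := ⟨0, by have := hδ i; omega⟩
    by_cases hs : s < t₀
    · have : (r ∘ h) ∘ e = e'.1 := by
        funext k
        rw [hcomp, hρ, if_pos]
        have := hl k
        have := hlk k
        omega
      rw [this]
      exact e'.2
    · have : (r ∘ h) ∘ e = base i (Y.gaifman.connectedComponentMk (e'.1 k₀)) := by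
        funext k
        rw [hcomp, hρ, if_neg,
          SimpleGraph.ConnectedComponent.sound (Y.gaifman_reachable e'.2 k k₀)]
        have := hl k
        omega
      rw [this]
      exact hbase i e' k₀

/-- If `linkStruct Y N` is balanced, then `Y` has a potential that agrees at corresponding
positions of any two edges of the same kind in the same component. -/
theorem exists_potential_of_balanced_linkStruct [Finite I] (hδ : ∀ i, 2 ≤ δ i) {w : I → ℕ → ℝ}
    (Y : RelStruct I δ) (N : ℕ) (h : (linkStruct Y N).Balanced w) :
    ∃ φ : Y.carrier → ℝ,
      (∀ i, ∀ e ∈ Y.rel i, ∀ j k : Fin (δ i), φ (e j) + w i k = φ (e k) + w i j) ∧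
      ∀ i, ∀ e ∈ Y.rel i, ∀ e' ∈ Y.rel i, ∀ k : Fin (δ i),
        Y.gaifman.Reachable (e k) (e' k) → φ (e k) = φ (e' k) := by
  classical
  obtain ⟨φ, hφ⟩ := h
  have hstep : ∀ (i : I) (e : Y.rel i) (k : Fin (δ i)) (t : ℕ),
      φ (linkVertex Y N e k t) = φ (linkVertex Y N e k 0) := by
    intro i e k t
    induction t with
    | zero => rfl
    | succ t ih =>
      obtain ⟨k', hk'⟩ : ∃ k' : Fin (δ i), k' ≠ k := by
        have := Fin.nontrivial_iff_two_le.mpr (hδ i)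
        exact exists_ne k
      have h1 := hφ i (fun j => linkVertex Y N e j t) ⟨e, t, fun _ => t, by simp, fun _ => rfl⟩ k k'
      have h2 := hφ i (fun j => linkVertex Y N e j (if j = k then t + 1 else t))
        ⟨e, t, fun j => if j = k then t + 1 else t,
          fun j => by by_cases hj : j = k <;> simp [hj], fun _ => rfl⟩ k k'
      simp only [if_pos, if_neg hk'] at h2
      linarith
  refine ⟨fun y => φ (Sum.inl y), fun i e he => ?_, fun i e he e' he' k hr => ?_⟩
  · exact hφ i (fun j => linkVertex Y N ⟨e, he⟩ j 0) ⟨⟨e, he⟩, 0, fun _ => 0, by simp, fun _ => rfl⟩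
  · have h1 := hstep i ⟨e, he⟩ k (N + 1)
    have h2 := hstep i ⟨e', he'⟩ k (N + 1)
    have h3 : linkVertex Y N ⟨e, he⟩ k (N + 1) = linkVertex Y N ⟨e', he'⟩ k (N + 1) := by
      simp only [linkVertex, lt_irrefl, dif_neg, not_false_eq_true]
      rw [SimpleGraph.ConnectedComponent.sound hr]
    rw [h3] at h1
    exact h1.symm.trans h2

theorem reflTransGen_shadowAdj_symm {A : RelStruct I δ} {a b : A.carrier}
    (h : Relation.ReflTransGen (shadowAdj A) a b) : Relation.ReflTransGen (shadowAdj A) b a := by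
  induction h with
  | refl => exact Relation.ReflTransGen.refl
  | tail _ hbc ih =>
    obtain ⟨s, hs⟩ := hbc
    exact ih.head ⟨s, hs.symm⟩

theorem reflTransGen_shadowAdj_of_mem (A : RelStruct I δ) {i : I} {e : Fin (δ i) → A.carrier}
    (he : e ∈ A.rel i) (j k : Fin (δ i)) :
    Relation.ReflTransGen (shadowAdj A) (e j) (e k) := by
  have key : ∀ (n : ℕ) (h0 : 0 < δ i) (hn : n < δ i),
      Relation.ReflTransGen (shadowAdj A) (e ⟨0, h0⟩) (e ⟨n, hn⟩) := by
    intro n h0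
    induction n with
    | zero => exact fun _ => Relation.ReflTransGen.refl
    | succ n ih =>
      exact fun hn => (ih (by omega)).tail ⟨⟨i, e, he, n, hn⟩, Or.inl ⟨rfl, rfl⟩⟩
  exact (reflTransGen_shadowAdj_symm (key j.1 (Nat.zero_lt_of_lt j.2) j.2)).trans
    (key k.1 (Nat.zero_lt_of_lt j.2) k.2)

theorem finite_shadowEdge [Finite I] (A : RelStruct I δ) : Finite (ShadowEdge A) := by
  have := A.finite
  have : ∀ i, Finite (A.rel i) := fun i => Subtype.finite
  refine Finite.of_injective
    (fun s : ShadowEdge A => (⟨s.i, ⟨s.e, s.mem⟩, ⟨s.j, Nat.lt_of_succ_lt s.hj⟩⟩ :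
      Σ i, A.rel i × Fin (δ i))) ?_
  rintro ⟨i, e, he, j, hj⟩ ⟨i', e', he', j', hj'⟩ h
  simp only [Sigma.mk.injEq] at h
  obtain ⟨rfl, h⟩ := h
  simp only [heq_eq_eq, Prod.mk.injEq, Subtype.mk.injEq, Fin.mk.injEq] at h
  obtain ⟨rfl, rfl⟩ := h
  rfl

theorem card_le_card_shadowEdge_add_one [Finite I] (A : RelStruct I δ) (hA : ShadowConnected A) :
    Nat.card A.carrier ≤ Nat.card (ShadowEdge A) + 1 := by
  have := A.nonempty
  have := A.finite
  have := finite_shadowEdge A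
  let G : SimpleGraph A.carrier := SimpleGraph.fromRel (shadowAdj A)
  have hG : G.Connected := by
    refine SimpleGraph.connected_iff_exists_forall_reachable _ |>.mpr
      ⟨Classical.arbitrary _, fun b => ?_⟩
    have h := hA (Classical.arbitrary _) b
    induction h with
    | refl => exact SimpleGraph.Reachable.refl _
    | @tail x y _ hxy ih =>
      by_cases hne : x = y
      · rwa [← hne]
      · exact ih.trans (SimpleGraph.Adj.reachable ⟨hne, Or.inl hxy⟩)
  refine hG.card_vert_le_card_edgeSet_add_one.trans (Nat.add_le_add_right ?_ 1)
  have hsub : G.edgeSet ⊆ Set.range fun s : ShadowEdge A => s(s.src, s.tgt) := by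
    intro x
    induction x with
    | _ a b =>
      rintro ⟨-, ⟨s, hs | hs⟩ | ⟨s, hs | hs⟩⟩ <;> refine ⟨s, ?_⟩ <;> simp [hs.1, hs.2, Sym2.eq_swap]
  exact (Nat.card_mono (Set.finite_range _) hsub).trans (Finite.card_range_le _)

/-- The image of the component `C` of `Y` under the real potential `φ`. -/
noncomputable def potentialImage (Y : RelStruct I δ) (φ : Y.carrier → ℝ)
    (C : Y.gaifman.ConnectedComponent) : RelStruct I δ where
  carrier := {x : ℝ // ∃ v, Y.gaifman.connectedComponentMk v = C ∧ φ v = x}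
  finite := by
    have := Y.finite
    exact ((Set.finite_range φ).subset fun x ⟨v, _, hv⟩ => ⟨v, hv⟩ :
      {x : ℝ | ∃ v, Y.gaifman.connectedComponentMk v = C ∧ φ v = x}.Finite)
  nonempty := ⟨⟨φ C.out, C.out, Quot.out_eq _, rfl⟩⟩
  rel i := {t | ∃ e ∈ Y.rel i, (∀ k, Y.gaifman.connectedComponentMk (e k) = C) ∧
    ∀ k, (t k).1 = φ (e k)}

theorem shadowConnected_potentialImage (Y : RelStruct I δ) (φ : Y.carrier → ℝ)
    (C : Y.gaifman.ConnectedComponent) : ShadowConnected (potentialImage Y φ C) := by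
  have key : ∀ (u v : Y.carrier) (_ : Y.gaifman.Walk u v)
      (hu : Y.gaifman.connectedComponentMk u = C) (hv : Y.gaifman.connectedComponentMk v = C),
      Relation.ReflTransGen (shadowAdj (potentialImage Y φ C)) ⟨φ u, u, hu, rfl⟩
        ⟨φ v, v, hv, rfl⟩ := by
    intro u v p
    induction p with
    | nil => exact fun _ _ => Relation.ReflTransGen.refl
    | @cons u x v hux _ ih =>
      intro hu hv
      have hx : Y.gaifman.connectedComponentMk x = C :=
        (SimpleGraph.ConnectedComponent.sound hux.reachable).symm.trans hu
      refine Relation.ReflTransGen.trans ?_ (ih hx hv)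
      obtain ⟨-, i, e, he, ⟨j, rfl⟩, ⟨k, rfl⟩⟩ := hux
      have hC : ∀ l, Y.gaifman.connectedComponentMk (e l) = C := fun l =>
        (SimpleGraph.ConnectedComponent.sound (Y.gaifman_reachable he l j)).trans hu
      exact reflTransGen_shadowAdj_of_mem (potentialImage Y φ C)
        (e := fun l => ⟨φ (e l), e l, hC l, rfl⟩) ⟨e, he, hC, fun _ => rfl⟩ j k
  rintro ⟨-, u, hu, rfl⟩ ⟨-, v, hv, rfl⟩
  obtain ⟨p⟩ : Y.gaifman.Reachable u v := SimpleGraph.ConnectedComponent.exact (hu.trans hv.symm)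
  exact key u v p hu hv

theorem atMostOneEdgePerKind_potentialImage (Y : RelStruct I δ) {φ : Y.carrier → ℝ}
    (hφ : ∀ i, ∀ e ∈ Y.rel i, ∀ e' ∈ Y.rel i, ∀ k : Fin (δ i),
      Y.gaifman.Reachable (e k) (e' k) → φ (e k) = φ (e' k))
    (C : Y.gaifman.ConnectedComponent) : AtMostOneEdgePerKind (potentialImage Y φ C) := by
  rintro i t ⟨e, he, hC, ht⟩ t' ⟨e', he', hC', ht'⟩
  funext k
  refine Subtype.ext ?_
  rw [ht, ht']
  exact hφ i e he e' he' k (SimpleGraph.ConnectedComponent.exact ((hC k).trans (hC' k).symm))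

/-- The weights given by the partial sums of `g`. -/
noncomputable def partialSums (g : I × ℕ → ℝ) (i : I) (j : ℕ) : ℝ :=
  ∑ l ∈ Finset.range j, g (i, l)

theorem isTreeStruct_potentialImage [Finite I] {g : I × ℕ → ℝ} (hg : LinearIndependent ℚ g)
    (Y : RelStruct I δ) {φ : Y.carrier → ℝ}
    (hφ : ∀ i, ∀ e ∈ Y.rel i, ∀ j k : Fin (δ i),
      φ (e j) + partialSums g i k = φ (e k) + partialSums g i j)
    (C : Y.gaifman.ConnectedComponent) (hC : AtMostOneEdgePerKind (potentialImage Y φ C)) :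
    IsTreeStruct (potentialImage Y φ C) := by
  classical
  let P := potentialImage Y φ C
  refine ⟨shadowConnected_potentialImage Y φ C, le_antisymm ?_
    (card_le_card_shadowEdge_add_one P (shadowConnected_potentialImage Y φ C))⟩
  have := finite_shadowEdge P
  have := Fintype.ofFinite (ShadowEdge P)
  have : Finite P.carrier := P.finite
  have := Fintype.ofFinite P.carrier
  let val : P.carrier → ℝ := Subtype.val
  let x₀ : P.carrier := P.nonempty.some
  let B : Finset ℝ := (Finset.univ.erase x₀).image fun x => val x - val x₀
  have hval : ∀ x, val x - val x₀ ∈ Submodule.span ℚ (B : Set ℝ) := by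
    intro x
    by_cases hx : x = x₀
    · rw [hx, sub_self]
      exact Submodule.zero_mem _
    · exact Submodule.subset_span (Finset.mem_coe.mpr (Finset.mem_image_of_mem _
        (Finset.mem_erase.mpr ⟨hx, Finset.mem_univ _⟩)))
  have hinj : Function.Injective fun s : ShadowEdge P => (s.i, s.j) := by
    rintro ⟨i, e, he, j, hj⟩ ⟨i', e', he', j', hj'⟩ h
    simp only [Prod.mk.injEq] at h
    obtain ⟨rfl, rfl⟩ := h
    obtain rfl := hC i e he e' he'
    rfl
  have hedge : ∀ s : ShadowEdge P, g (s.i, s.j) = val s.tgt - val s.src := by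
    rintro ⟨i, t, ⟨e, he, hC, ht⟩, j, hj⟩
    have h := hφ i e he ⟨j, Nat.lt_of_succ_lt hj⟩ ⟨j + 1, hj⟩
    rw [← ht, ← ht] at h
    simp only [partialSums, Finset.sum_range_succ] at h
    simp only [val, ShadowEdge.src, ShadowEdge.tgt]
    linarith
  have hspan : Set.range (g ∘ fun s : ShadowEdge P => (s.i, s.j)) ≤
      (Submodule.span ℚ (B : Set ℝ) : Set ℝ) := by
    rintro _ ⟨s, rfl⟩
    have h := Submodule.sub_mem _ (hval s.tgt) (hval s.src)
    rw [sub_sub_sub_cancel_right, ← hedge] at h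
    exact h
  have h1 := linearIndependent_le_span_aux' _ (hg.comp _ hinj) (B : Set ℝ) hspan
  have h2 : B.card ≤ _ := Finset.card_image_le
  rw [Finset.card_erase_of_mem (Finset.mem_univ _), Finset.card_univ] at h2
  have h3 : 0 < Fintype.card P.carrier := Fintype.card_pos_iff.mpr ⟨x₀⟩
  have h4 : Fintype.card (B : Set ℝ) = B.card := Fintype.card_coe B
  rw [Nat.card_eq_fintype_card, Nat.card_eq_fintype_card]
  change Fintype.card (ShadowEdge P) + 1 ≤ Fintype.card P.carrier
  omega

/-- A structure with a potential that separates the positions of edges, and agrees at corresponding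
positions of any two edges of the same kind in the same component, maps to the sum of all trees
with at most one edge of each kind. -/
theorem homTo_sigmaSum_of_potential [Finite I] (hδ : ∀ i, 2 ≤ δ i) {J : Type} (hJfin : Finite J)
    (hJne : Nonempty J) {T : J → RelStruct I δ}
    (hT : ∀ W : RelStruct I δ, W.IsTreeStruct → W.AtMostOneEdgePerKind → ∃ j, W.Isomorphic (T j))
    {g : I × ℕ → ℝ} (hg : LinearIndependent ℚ g) (Y : RelStruct I δ) {φ : Y.carrier → ℝ}
    (hφ : ∀ i, ∀ e ∈ Y.rel i, ∀ j k : Fin (δ i),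
      φ (e j) + partialSums g i k = φ (e k) + partialSums g i j)
    (hφ' : ∀ i, ∀ e ∈ Y.rel i, ∀ e' ∈ Y.rel i, ∀ k : Fin (δ i),
      Y.gaifman.Reachable (e k) (e' k) → φ (e k) = φ (e' k)) :
    HomTo Y (sigmaSum hJfin hJne T) := by
  have hex : ∀ C, ∃ j, HomTo (potentialImage Y φ C) (T j) := fun C => by
    have hC := atMostOneEdgePerKind_potentialImage Y hφ' C
    obtain ⟨j, f, hf, -⟩ := hT _ (isTreeStruct_potentialImage hg Y hφ C hC) hC
    exact ⟨j, f, hf⟩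
  choose j f hf using hex
  let F : Y.carrier → (sigmaSum hJfin hJne T).carrier := fun v =>
    ⟨j (Y.gaifman.connectedComponentMk v), f _ ⟨φ v, v, rfl, rfl⟩⟩
  have hF : ∀ v C (h : Y.gaifman.connectedComponentMk v = C), F v = ⟨j C, f C ⟨φ v, v, h, rfl⟩⟩ := by
    rintro v _ rfl
    rfl
  refine ⟨F, fun i e he => ?_⟩
  let k₀ : Fin (δ i) := ⟨0, (hδ i).trans_lt' Nat.zero_lt_two⟩
  have hC : ∀ k, Y.gaifman.connectedComponentMk (e k) = Y.gaifman.connectedComponentMk (e k₀) :=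
    fun k => SimpleGraph.ConnectedComponent.sound (Y.gaifman_reachable he k k₀)
  exact ⟨_, _, hf (Y.gaifman.connectedComponentMk (e k₀)) i
    (fun k => ⟨φ (e k), e k, hC k, rfl⟩) ⟨e, he, hC, fun _ => rfl⟩, funext fun k => hF _ _ (hC k)⟩

end RelStruct

end ThesisFormal

open ThesisFormal RelStruct in
/-- Let `Q` be a finite maximal antichain in the homomorphism
order and let `D*` be the sum of all Δ-trees with at most one edge of each
kind. If every `q ∈ Q` has the property that whenever `Y < q` and `Y → D*`
there exists `X` with `Y < X < q` and `X ↛ D*`, then `Q` splits. -/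
theorem stmt_16 {I : Type} [Finite I] {δ : I → ℕ} (hδ : ∀ i, 2 ≤ δ i)
    (J : Type) (hJfin : Finite J) (hJne : Nonempty J)
    (T : J → RelStruct I δ)
    (hT : ∀ j, (T j).IsTreeStruct ∧ (T j).AtMostOneEdgePerKind)
    (hTall : ∀ W : RelStruct I δ, W.IsTreeStruct → W.AtMostOneEdgePerKind →
      ∃ j, W.Isomorphic (T j))
    (hTinj : ∀ j j', (T j).Isomorphic (T j') → j = j')
    (Dstar : RelStruct I δ) (hDstar : Dstar = sigmaSum hJfin hJne T)
    (Q : Set (RelStruct I δ)) (hQfin : Q.Finite) (hQ : IsMaxAntichain Q)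
    (hgap : ∀ q ∈ Q, ∀ Y : RelStruct I δ, StrictHom Y q → Y.HomTo Dstar →
      ∃ X : RelStruct I δ, StrictHom Y X ∧ StrictHom X q ∧ ¬ X.HomTo Dstar) :
    Splits Q := by
  classical
  obtain ⟨-, hanti, hmax⟩ := hQ
  obtain ⟨g, hg⟩ := exists_linearIndependent_real (I × ℕ)
  let Supports : Set (RelStruct I δ) → Prop := fun P =>
    ∀ X, ∀ q ∈ Q, StrictHom q X → ∃ F ∈ P, HomTo F X
  have hsuppQ : Supports Q := fun X q hq h => ⟨q, hq, h.1⟩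
  obtain ⟨P, hPQ, hP⟩ : ∃ P, P ⊆ Q ∧ Minimal (fun P => P ⊆ Q ∧ Supports P) P := by
    obtain ⟨P, hP⟩ := (hQfin.finite_subsets.subset (fun P hP => hP.1 :
      {P | P ⊆ Q ∧ Supports P} ⊆ {P | P ⊆ Q})).exists_minimal ⟨Q, subset_rfl, hsuppQ⟩
    exact ⟨P, hP.1.1, hP⟩
  have hsupp : Supports P := hP.1.2
  have hbal : ∀ F ∈ P, F.Balanced (partialSums g) := by
    intro F hF
    have hnot : ¬ Supports (P \ {F}) := fun h =>
      (hP.2 ⟨Set.sdiff_subset.trans hPQ, h⟩ Set.sdiff_subset hF).2 rfl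
    obtain ⟨X, q, hq, hqX, hX⟩ : ∃ X, ∃ q ∈ Q, StrictHom q X ∧ ∀ F' ∈ P \ {F}, ¬ HomTo F' X := by
      simp only [Supports] at hnot
      push Not at hnot
      exact hnot
    have hXQ : ∀ A ∈ Q, ¬ HomTo X A := by
      intro A hA h
      by_cases hAq : q = A
      · exact hqX.2 (hAq ▸ h)
      · exact (hanti hq hA hAq).1 (hqX.1.trans h)
    obtain ⟨Z, hZX, hZQ, hZ⟩ :=
      exists_locally_balanced (partialSums g) X Q hQfin hXQ (Nat.card F.carrier)
    obtain ⟨q', hq', h | h⟩ := hmax Z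
    · exact absurd h (hZQ q' hq')
    obtain ⟨F', hF', hF'Z⟩ := hsupp Z q' hq' ⟨h, hZQ q' hq'⟩
    obtain rfl : F' = F := by
      by_contra hne
      exact hX F' ⟨hF', hne⟩ (hF'Z.trans hZX)
    exact hZ F' le_rfl hF'Z
  refine ⟨P, Q \ P, Set.union_sdiff_cancel hPQ, Set.disjoint_sdiff_right, fun X => ?_⟩
  by_contra! ⟨hXP, hXR⟩
  have hbelow : ∀ q ∈ Q, ¬ StrictHom q X := fun q hq h => by
    obtain ⟨F, hF, hFX⟩ := hsupp X q hq h
    exact hXP F hF hFX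
  obtain ⟨F, hF, hXF⟩ : ∃ F ∈ P, HomTo X F := by
    obtain ⟨q, hq, h | h⟩ := hmax X
    · exact ⟨q, by_contra fun hqP => hXR q ⟨hq, hqP⟩ h, h⟩
    · have hXq : HomTo X q := by_contra fun h' => hbelow q hq ⟨h, h'⟩
      exact ⟨q, by_contra fun hqP => hXR q ⟨hq, hqP⟩ hXq, hXq⟩
  obtain ⟨Y, hXY, hYF, hYD⟩ : ∃ Y, HomTo X Y ∧ StrictHom Y F ∧ ¬ HomTo Y Dstar := by
    by_cases hXD : HomTo X Dstar
    · obtain ⟨Y, hXY, hYF, hYD⟩ := hgap F (hPQ hF) X ⟨hXF, hXP F hF⟩ hXD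
      exact ⟨Y, hXY.1, hYF, hYD⟩
    · exact ⟨X, ⟨id, fun _ _ he => he⟩, ⟨hXF, hXP F hF⟩, hXD⟩
  have hYP : ∀ F' ∈ P, ¬ HomTo F' Y := by
    intro F' hF' h
    by_cases hne : F' = F
    · exact hYF.2 (hne ▸ h)
    · exact (hanti (hPQ hF') (hPQ hF) hne).1 (h.trans hYF.1)
  obtain ⟨N, hN⟩ : ∃ N, ∀ F' ∈ Q, Nat.card F'.carrier < N := by
    obtain ⟨N, hN⟩ := (hQfin.image fun F' => Nat.card F'.carrier).bddAbove
    exact ⟨N + 1, fun F' hF' => Nat.lt_succ_of_le (hN ⟨F', hF', rfl⟩)⟩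
  let Z := Y.sum (linkStruct Y N)
  have hZ : ∀ q ∈ Q, ¬ HomTo Z q := by
    intro q hq h
    by_cases hqP : q ∈ P
    · obtain ⟨φ, hφ, hφ'⟩ := exists_potential_of_balanced_linkStruct hδ Y N
        (Balanced.of_homTo ((homTo_sum_right Y (linkStruct Y N)).trans h) (hbal q hqP))
      exact hYD (hDstar ▸ homTo_sigmaSum_of_potential hδ hJfin hJne hTall hg Y hφ hφ')
    · exact hXR q ⟨hq, hqP⟩ (hXY.trans ((homTo_sum_left Y (linkStruct Y N)).trans h))
  obtain ⟨q, hq, h | h⟩ := hmax Z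
  · exact hZ q hq h
  · obtain ⟨F', hF', hF'Z⟩ := hsupp Z q hq ⟨h, hZ q hq⟩
    exact hYP F' hF' (homTo_of_homTo_sum_linkStruct hδ Y F' N (hN F' (hPQ hF')) hF'Z)
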